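/- arXiv:1210.6423 — 2 statements merged into one kernel-verified Lean document; each statement's English description precedes it below -/
import Mathlib

section
/- Let N₀ > 0 and P₂ ≥ 0. Define h(p) = −2p·ln p − (1 − 2p)·ln(1/2 − p) (with 0·ln 0 = 0) and g(p) = (1/2)·ln(1 + (P₂ + 6p + 1)/N₀) for p ∈ [0, 1/2]. If g(1/2) ≤ ln 2, then max_{p ∈ [0, 1/2]} min{h(p), g(p)} = g(1/2) = (1/2)·ln(1 + (P₂ + 4)/N₀), and this maximum is attained at p = 1/2. -/
/-- The entropy (in nats) of the symmetric four-point input distribution,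
`h(p) = −2p ln p − (1 − 2p) ln(1/2 − p)`.
(Here `Real.log 0 = 0`, so the convention `0 · ln 0 = 0` holds automatically.) -/
noncomputable def fourPointEntropy (p : ℝ) : ℝ :=
  -2 * p * Real.log p - (1 - 2 * p) * Real.log (1 / 2 - p)

/-- The second-hop Gaussian capacity (in nats) with harvested energy `6p + 1`:
`g(p) = (1/2) ln(1 + (P₂ + 6p + 1)/N₀)`. -/
noncomputable def secondHopCapacity (N₀ P₂ p : ℝ) : ℝ :=
  (1 / 2) * Real.log (1 + (P₂ + 6 * p + 1) / N₀)

theorem fourPointEntropy_half : fourPointEntropy (1 / 2) = Real.log 2 := by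
  simp [fourPointEntropy]

theorem secondHopCapacity_le_of_le {N₀ P₂ p q : ℝ} (hN₀ : 0 < N₀) (hP₂ : 0 ≤ P₂)
    (hp : 0 ≤ p) (hpq : p ≤ q) : secondHopCapacity N₀ P₂ p ≤ secondHopCapacity N₀ P₂ q := by
  unfold secondHopCapacity
  gcongr

/-- Low-SNR regime: if `g(1/2) ≤ ln 2`, then the maximum over `p ∈ [0, 1/2]` of
`min{h(p), g(p)}` equals `g(1/2) = (1/2) ln(1 + (P₂ + 4)/N₀)` and is attained at
`p = 1/2` (maximal energy transfer to the relay). -/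
theorem multihop_low_snr_optimum (N₀ P₂ : ℝ) (hN₀ : 0 < N₀) (hP₂ : 0 ≤ P₂)
    (hlow : secondHopCapacity N₀ P₂ (1 / 2) ≤ Real.log 2) :
    (∀ p ∈ Set.Icc (0 : ℝ) (1 / 2),
      min (fourPointEntropy p) (secondHopCapacity N₀ P₂ p)
        ≤ secondHopCapacity N₀ P₂ (1 / 2)) ∧
    (min (fourPointEntropy (1 / 2)) (secondHopCapacity N₀ P₂ (1 / 2))
      = secondHopCapacity N₀ P₂ (1 / 2)) ∧
    (secondHopCapacity N₀ P₂ (1 / 2) = (1 / 2) * Real.log (1 + (P₂ + 4) / N₀)) := by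
  refine ⟨fun p hp => (min_le_right _ _).trans
    (secondHopCapacity_le_of_le hN₀ hP₂ hp.1 hp.2), ?_, ?_⟩
  · rw [fourPointEntropy_half]
    exact min_eq_right hlow
  · unfold secondHopCapacity
    ring_nf
end

section
/- Let N₀ > 0 and P₂ ≥ 0. Define h(p) = −2p·ln p − (1 − 2p)·ln(1/2 − p) (with 0·ln 0 = 0) and g(p) = (1/2)·ln(1 + (P₂ + 6p + 1)/N₀) for p ∈ [0, 1/2]. If g(1/4) ≥ 2·ln 2, then max_{p ∈ [0, 1/2]} min{h(p), g(p)} = 2·ln 2, and this maximum is attained at p = 1/4. -/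
/-- The tangent-line bound for `x ↦ -x ln x` at `1/4`. -/
theorem neg_mul_log_le_tangent_quarter {x : ℝ} (hx : 0 ≤ x) :
    -(x * Real.log x) ≤ 2 * x * Real.log 2 + (1 / 4 - x) := by
  rcases hx.eq_or_lt with rfl | hx
  · norm_num
  · have hlog : Real.log (1 / (4 * x)) = -(2 * Real.log 2) - Real.log x := by
      rw [one_div, Real.log_inv, Real.log_mul (by norm_num) hx.ne',
        show (4 : ℝ) = 2 ^ 2 by norm_num, Real.log_pow]
      push_cast
      ring
    have hle := mul_le_mul_of_nonneg_left
      (Real.log_le_sub_one_of_pos (show 0 < 1 / (4 * x) by positivity)) hx.le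
    have hmul : x * (1 / (4 * x) - 1) = 1 / 4 - x := by
      field_simp
    rw [hlog, hmul] at hle
    linarith

theorem fourPointEntropy_le {p : ℝ} (hp : p ∈ Set.Icc (0 : ℝ) (1 / 2)) :
    fourPointEntropy p ≤ 2 * Real.log 2 := by
  have h₁ := neg_mul_log_le_tangent_quarter hp.1
  have h₂ := neg_mul_log_le_tangent_quarter (sub_nonneg.2 hp.2)
  unfold fourPointEntropy
  linarith

theorem fourPointEntropy_quarter : fourPointEntropy (1 / 4) = 2 * Real.log 2 := by
  have hlog : Real.log (1 / 4) = -(2 * Real.log 2) := by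
    rw [one_div, Real.log_inv, show (4 : ℝ) = 2 ^ 2 by norm_num, Real.log_pow]
    push_cast
    ring
  rw [fourPointEntropy, show (1 / 2 - 1 / 4 : ℝ) = 1 / 4 by norm_num, hlog]
  ring

/-- High-SNR regime: if `g(1/4) ≥ 2 ln 2`, then the maximum over `p ∈ [0, 1/2]` of
`min{h(p), g(p)}` equals `2 ln 2` and is attained at `p = 1/4` (maximal information
transfer to the relay). -/
theorem multihop_high_snr_optimum (N₀ P₂ : ℝ) (hN₀ : 0 < N₀) (hP₂ : 0 ≤ P₂)
    (hhigh : 2 * Real.log 2 ≤ secondHopCapacity N₀ P₂ (1 / 4)) :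
    (∀ p ∈ Set.Icc (0 : ℝ) (1 / 2),
      min (fourPointEntropy p) (secondHopCapacity N₀ P₂ p) ≤ 2 * Real.log 2) ∧
    (min (fourPointEntropy (1 / 4)) (secondHopCapacity N₀ P₂ (1 / 4))
      = 2 * Real.log 2) := by
  refine ⟨fun p hp => (min_le_left _ _).trans (fourPointEntropy_le hp), ?_⟩
  rw [fourPointEntropy_quarter, min_eq_left hhigh]
end
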